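/- For every integer $n \ge 1$ and every integer $k \ge 1$, the inequality $\frac{2}{n!}\big(k(k+n-1)\big)^{n/2} < \binom{n+k}{k} + \binom{n+k-1}{k-1}$ holds. -/

import Mathlib

/-- Squared lower bound for rising factorials, obtained by pairing opposite factors. -/
theorem pow_le_ascFactorial_sq (n k : ℕ) :
    (k * (k + n - 1)) ^ n ≤ k.ascFactorial n ^ 2 := by
  have h : k.ascFactorial n ^ 2 = ∏ i ∈ Finset.range n, (k + i) * (k + (n - 1 - i)) := by
    rw [Finset.prod_mul_distrib, Finset.prod_range_reflect (fun i => k + i) n, sq,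
      Nat.ascFactorial_eq_prod_range]
  calc (k * (k + n - 1)) ^ n = ∏ _i ∈ Finset.range n, k * (k + n - 1) := by simp
    _ ≤ ∏ i ∈ Finset.range n, (k + i) * (k + (n - 1 - i)) := by
      refine Finset.prod_le_prod' fun i hi => ?_
      obtain ⟨j, rfl⟩ : ∃ j, n = i + j + 1 := Nat.exists_eq_add_of_lt (Finset.mem_range.mp hi)
      rw [show k + (i + j + 1) - 1 = k + i + j by lia, show i + j + 1 - 1 - i = j by lia]
      nlinarith [Nat.zero_le (i * j)]
    _ = k.ascFactorial n ^ 2 := h.symm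

/-- Rising factorials dominate the half-integer powers appearing in the Weyl function. -/
theorem rpow_half_le_ascFactorial (n k : ℕ) :
    ((k * (k + n - 1) : ℕ) : ℝ) ^ ((n : ℝ) / 2) ≤ (k.ascFactorial n : ℝ) := by
  refine le_of_sq_le_sq ?_ (Nat.cast_nonneg _)
  rw [← Real.rpow_mul_natCast (Nat.cast_nonneg _), Nat.cast_ofNat,
    div_mul_cancel₀ _ (two_ne_zero' ℝ), Real.rpow_natCast]
  exact_mod_cast pow_le_ascFactorial_sq n k

/-- Rising factorials of positive length are strictly increasing in the base. -/
theorem ascFactorial_lt_succ_ascFactorial {n k : ℕ} (hn : 1 ≤ n) :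
    k.ascFactorial n < (k + 1).ascFactorial n := by
  simp only [Nat.ascFactorial_eq_prod_range]
  obtain ⟨m, rfl⟩ := Nat.exists_eq_add_of_le' hn
  rw [Finset.prod_range_succ', Finset.prod_range_succ, mul_comm, mul_comm _ (k + 1 + m)]
  have h : ∏ i ∈ Finset.range m, (k + (i + 1)) = ∏ i ∈ Finset.range m, (k + 1 + i) :=
    Finset.prod_congr rfl fun i _ => by ring
  rw [h]
  exact Nat.mul_lt_mul_of_pos_right (by lia) (Finset.prod_pos fun i _ => by lia)

/-- The Weyl function of the sphere is strictly less than its eigenvalue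
counting function at every positive eigenvalue `k(k+n-1)`. -/
theorem stmt6 (n k : ℕ) (hn : 1 ≤ n) (hk : 1 ≤ k) :
    (2 / (Nat.factorial n : ℝ)) * ((k * (k + n - 1) : ℕ) : ℝ) ^ ((n : ℝ) / 2)
      < (Nat.choose (n + k) k : ℝ) + (Nat.choose (n + k - 1) (k - 1) : ℝ) := by
  have h1 : ((k + 1).ascFactorial n : ℝ) = n.factorial * (n + k).choose k := by
    rw [Nat.ascFactorial_eq_factorial_mul_choose, add_comm n k, Nat.choose_symm_add]
    push_cast; rfl
  have h2 : (k.ascFactorial n : ℝ) = n.factorial * (n + k - 1).choose (k - 1) := by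
    obtain ⟨j, rfl⟩ := Nat.exists_eq_add_of_le' hk
    rw [Nat.ascFactorial_eq_factorial_mul_choose, show n + (j + 1) - 1 = j + n by lia,
      Nat.add_sub_cancel, Nat.choose_symm_add]
    push_cast; rfl
  have h3 : (k.ascFactorial n : ℝ) < (k + 1).ascFactorial n :=
    mod_cast ascFactorial_lt_succ_ascFactorial hn
  have hpos : (0 : ℝ) < n.factorial := mod_cast n.factorial_pos
  rw [div_mul_eq_mul_div, div_lt_iff₀ hpos]
  linarith [rpow_half_le_ascFactorial n k]
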